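/- Lower prices are super-additive: if A_1, …, A_k is a partition of A ⊆ M, then the lower price of the combined tranche A is at least the sum of the lower prices of the tranches A_i, i.e., ess sup_{τ ∈ S^A_t} ess inf_{σ ∈ S^{-A}_t} E(V̂^A_θ(τ,σ)|F_t) ≥ Σ_{i=1}^k ess sup_{τ_i ∈ S^{A_i}_t} ess inf_{σ_i ∈ S^{-A_i}_t} E(V̂^{A_i}_θ(τ_i,σ_i)|F_t). -/

import Mathlib

open MeasureTheory Filter

/-- `g` is the essential supremum (least upper bound in the a.s. order, among
measurable functions) of the family `f`. -/
def IsEssSupFam {Ω α : Type*} {m : MeasurableSpace Ω} (μ : Measure Ω)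
    (f : α → Ω → ℝ) (g : Ω → ℝ) : Prop :=
  (∀ a, f a ≤ᵐ[μ] g) ∧
    ∀ h : Ω → ℝ, Measurable h → (∀ a, f a ≤ᵐ[μ] h) → g ≤ᵐ[μ] h

/-- `g` is the essential infimum (greatest lower bound in the a.s. order, among
measurable functions) of the family `f`. -/
def IsEssInfFam {Ω α : Type*} {m : MeasurableSpace Ω} (μ : Measure Ω)
    (f : α → Ω → ℝ) (g : Ω → ℝ) : Prop :=
  (∀ a, g ≤ᵐ[μ] f a) ∧
    ∀ h : Ω → ℝ, Measurable h → (∀ a, h ≤ᵐ[μ] f a) → h ≤ᵐ[μ] g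

/-- The profile in which the coalition `A` plays `τ` while all remaining players
play according to `ρ`, i.e. `(τ^A, ρ^{-A})`. -/
def comb {ι : Type*} [DecidableEq ι] {S : ι → Type*} (A : Finset ι)
    (τ ρ : ∀ i, S i) : ∀ i, S i :=
  fun i => if i ∈ A then τ i else ρ i

/-- A measurable upper bound of all sums of members of finitely many families is an upper bound
of the sum of their essential suprema. -/
theorem IsEssSupFam.sum_le {Ω κ α : Type*} {m : MeasurableSpace Ω} [DecidableEq κ] [Nonempty α]
    {μ : Measure Ω} {f : κ → α → Ω → ℝ} {L : κ → Ω → ℝ}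
    (hf : ∀ i a, Measurable (f i a)) (hLmeas : ∀ i, Measurable (L i))
    (hL : ∀ i, IsEssSupFam μ (f i) (L i)) (s : Finset κ) {h : Ω → ℝ} (hh : Measurable h)
    (hle : ∀ t : κ → α, (fun ω => ∑ i ∈ s, f i (t i) ω) ≤ᵐ[μ] h) :
    (fun ω => ∑ i ∈ s, L i ω) ≤ᵐ[μ] h := by
  induction s using Finset.induction_on generalizing h with
  | empty => simpa using hle fun _ => Classical.arbitrary α
  | insert a s ha ih =>
    have key : L a ≤ᵐ[μ] fun ω => h ω - ∑ i ∈ s, L i ω := by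
      refine (hL a).2 _ (hh.sub (Finset.measurable_fun_sum s fun i _ => hLmeas i)) fun b => ?_
      have hs : (fun ω => ∑ i ∈ s, L i ω) ≤ᵐ[μ] fun ω => h ω - f a b ω := by
        refine ih (hh.sub (hf a b)) fun t => ?_
        filter_upwards [hle (Function.update t a b)] with ω hω
        have hsum : ∑ i ∈ s, f i (Function.update t a b i) ω = ∑ i ∈ s, f i (t i) ω :=
          Finset.sum_congr rfl fun i hi => by
            rw [Function.update_of_ne (ne_of_mem_of_not_mem hi ha)]
        rw [Finset.sum_insert ha, hsum, Function.update_self] at hω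
        linarith
      filter_upwards [hs] with ω hω
      linarith
    filter_upwards [key] with ω hω
    rw [Finset.sum_insert ha]
    linarith

/-- Strategies chosen separately on disjoint coalitions can be glued to one profile. -/
theorem exists_profile_eq_on {ι κ : Type*} {S : ι → Type*} [∀ i, Nonempty (S i)]
    {P : κ → Finset ι} (hdisj : ∀ i j, i ≠ j → Disjoint (P i) (P j)) (t : κ → ∀ j, S j) :
    ∃ τ : ∀ j, S j, ∀ i, ∀ j ∈ P i, τ j = t i j := by
  classical
  refine ⟨fun j => if h : ∃ i, j ∈ P i then t h.choose j else Classical.arbitrary _, ?_⟩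
  intro i j hj
  have h : ∃ i, j ∈ P i := ⟨i, hj⟩
  have hi : h.choose = i := by
    by_contra hne
    exact Finset.disjoint_left.mp (hdisj _ _ hne) h.choose_spec hj
  simp only [dif_pos h, hi]

/-- Lower prices are super-additive: if `A_1, …, A_k` is a partition of `A`,
then the lower price of the combined tranche `A` (the essential supremum over
the coalition's strategies of the essential infimum over opposing strategies of
the conditional expected payoff) is a.s. at least the sum of the lower prices
of the tranches `A_i`. -/
theorem lower_prices_superadditive {Ω : Type*} {m0 : MeasurableSpace Ω}
    (μ : Measure Ω) [IsProbabilityMeasure μ]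
    {ι : Type*} [Fintype ι] [DecidableEq ι] {S : ι → Type*} [∀ i, Nonempty (S i)]
    (H : ι → (∀ i, S i) → Ω → ℝ) (hHmeas : ∀ j s, Measurable (H j s))
    (g : Ω → ℝ) (hg : Integrable g μ)
    (hgb : ∀ j s, ∀ᵐ ω ∂μ, |H j s ω| ≤ g ω)
    (A : Finset ι) (k : ℕ) (P : Fin k → Finset ι)
    (hdisj : ∀ i j : Fin k, i ≠ j → Disjoint (P i) (P j))
    (hcover : ∀ x, x ∈ A ↔ ∃ i : Fin k, x ∈ P i)
    (GA : (∀ i, S i) → Ω → ℝ) (hGAmeas : ∀ τ, Measurable (GA τ))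
    (hGA : ∀ τ, IsEssInfFam μ
      (fun ρ : ∀ i, S i => fun ω => ∑ j ∈ A, H j (comb A τ ρ) ω) (GA τ))
    (LA : Ω → ℝ) (hLAmeas : Measurable LA) (hLA : IsEssSupFam μ GA LA)
    (G : Fin k → (∀ i, S i) → Ω → ℝ) (hGmeas : ∀ i τ, Measurable (G i τ))
    (hG : ∀ (i : Fin k) τ, IsEssInfFam μ
      (fun ρ : ∀ i, S i => fun ω => ∑ j ∈ P i, H j (comb (P i) τ ρ) ω) (G i τ))
    (L : Fin k → Ω → ℝ) (hLmeas : ∀ i, Measurable (L i))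
    (hL : ∀ i : Fin k, IsEssSupFam μ (G i) (L i))
    (hlat : ∀ (i : Fin k) (τ τ' : ∀ i, S i), ∃ τ'' : ∀ i, S i,
      ∀ᵐ ω ∂μ, max (G i τ ω) (G i τ' ω) ≤ G i τ'' ω) :
    (fun ω => ∑ i : Fin k, L i ω) ≤ᵐ[μ] LA := by
  refine IsEssSupFam.sum_le hGmeas hLmeas hL Finset.univ hLAmeas fun t => ?_
  obtain ⟨τ, hτ⟩ := exists_profile_eq_on hdisj t
  refine EventuallyLE.trans ?_ (hLA.1 τ)
  refine (hGA τ).2 _ (Finset.measurable_fun_sum _ fun i _ => hGmeas i (t i)) fun ρ => ?_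
  have hA : A = Finset.univ.biUnion P := by
    ext x
    simp [hcover]
  have hcomb : ∀ i, comb (P i) (t i) (comb A τ ρ) = comb A τ ρ := by
    intro i
    funext j
    by_cases hj : j ∈ P i
    · have hjA : j ∈ A := (hcover j).2 ⟨i, hj⟩
      simp [comb, hj, hjA, hτ i j hj]
    · simp [comb, hj]
  have hall := ae_all_iff.2 fun i => (hG i (t i)).1 (comb A τ ρ)
  filter_upwards [hall] with ω hω
  have hsplit : ∑ j ∈ A, H j (comb A τ ρ) ω = ∑ i, ∑ j ∈ P i, H j (comb A τ ρ) ω := by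
    conv_lhs => rw [hA, Finset.sum_biUnion fun i _ j _ hij => hdisj i j hij]
    rw [← hA]
  rw [hsplit]
  refine Finset.sum_le_sum fun i _ => ?_
  simpa only [hcomb] using hω i
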